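/- arXiv:1701.07313 — 3 statements merged into one kernel-verified Lean document; each statement's English description precedes it below -/
import Mathlib

section
/- Let G be a simple graph on a finite vertex set V with |V| = n. In ℝ^V with standard basis (e_v)_{v∈V}, the dimension of the ℝ-linear span of { e_u + e_v : {u,v} is an edge of G } equals n minus the number of connected components of G that are bipartite, where isolated vertices count as bipartite components. -/
open scoped Classical

/-- The set `{ e_u + e_v : {u,v} an edge of G }` in `ℝ^V`. -/
def edgeVectors {V : Type*} [DecidableEq V] (G : SimpleGraph V) : Set (V → ℝ) :=
  {w | ∃ u v : V, G.Adj u v ∧ w = Pi.single u (1 : ℝ) + Pi.single v (1 : ℝ)}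

lemma aux_const {V : Type*} {α : Type*} (G : SimpleGraph V) (f : V → α)
    (hf : ∀ u v, G.Adj u v → f u = f v) {u v : V} (h : G.Reachable u v) : f u = f v := by
  obtain ⟨p⟩ := h
  induction p with
  | nil => rfl
  | cons h _ ih => exact (hf _ _ h).trans ih

lemma aux_mem {V : Type*} [Fintype V] [DecidableEq V] (G : SimpleGraph V) (x : V → ℝ) :
    x ∈ (Submodule.span ℝ (edgeVectors G)).dualAnnihilator.comap
      (dotProductEquiv ℝ V).toLinearMap ↔ ∀ u v, G.Adj u v → x u + x v = 0 := by
  rw [Submodule.mem_comap, Submodule.mem_dualAnnihilator]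
  constructor
  · intro h u v huv
    have := h _ (Submodule.subset_span ⟨u, v, huv, rfl⟩)
    simpa [dotProduct_add] using this
  · intro h w hw
    induction hw using Submodule.span_induction with
    | mem w hw =>
      obtain ⟨u, v, huv, rfl⟩ := hw
      simpa [dotProduct_add] using h u v huv
    | zero => simp
    | add a b _ _ ha hb => rw [map_add, ha, hb, add_zero]
    | smul a b _ hb => rw [map_smul, hb, smul_zero]

lemma aux_color {V : Type*} (G : SimpleGraph V) (x : V → ℝ)
    (hx : ∀ u v, G.Adj u v → x u + x v = 0) (v : V) (hv : x v ≠ 0) :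
    (G.induce (G.connectedComponentMk v).supp).Colorable 2 := by
  have hne : ∀ w, w ∈ (G.connectedComponentMk v).supp → x w ≠ 0 := by
    intro w hw
    have hr : G.Reachable w v := SimpleGraph.ConnectedComponent.exact hw
    have := aux_const G (fun u => |x u|) (fun a b hab => by
      have := hx a b hab
      have h2 : x a = - x b := by linarith
      simp [h2]) hr
    intro h0
    simp [h0] at this
    exact hv (abs_eq_zero.mp this.symm)
  refine ⟨SimpleGraph.Coloring.mk (fun w => if 0 < x w.1 then (0 : Fin 2) else 1) ?_⟩
  rintro ⟨a, ha⟩ ⟨b, hb⟩ hab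
  have h1 := hx a b hab
  have h2 := hne a ha
  have h3 := hne b hb
  dsimp only
  rcases lt_or_gt_of_ne h2 with h | h
  · rw [if_neg (by linarith), if_pos (by linarith)]; decide
  · rw [if_pos (by linarith), if_neg (by linarith)]; decide

lemma aux_sign {V : Type*} (G : SimpleGraph V) : ∃ s : V → ℝ, (∀ v, s v * s v = 1) ∧
    ∀ u v, G.Adj u v → (G.induce (G.connectedComponentMk v).supp).Colorable 2 →
      s u = - s v := by
  have h : ∀ c : G.ConnectedComponent, ∃ s : V → ℝ, (∀ v, s v * s v = 1) ∧
      ((G.induce c.supp).Colorable 2 → ∀ u ∈ c.supp, ∀ v ∈ c.supp, G.Adj u v → s u = - s v) := by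
    intro c
    by_cases hc : (G.induce c.supp).Colorable 2
    · obtain ⟨C⟩ := hc
      refine ⟨fun v => if h : v ∈ c.supp then (if C ⟨v, h⟩ = 0 then 1 else -1) else 1, ?_, ?_⟩
      · intro v
        dsimp only
        split_ifs <;> norm_num
      · intro _ u hu v hv huv
        have hne : C ⟨u, hu⟩ ≠ C ⟨v, hv⟩ := C.valid (by exact huv)
        simp only [hu, hv, dif_pos]
        generalize C ⟨u, hu⟩ = a at hne
        generalize C ⟨v, hv⟩ = b at hne
        fin_cases a <;> fin_cases b <;> simp_all
    · exact ⟨fun _ => 1, by simp, fun h => absurd h hc⟩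
  choose s hs1 hs2 using h
  refine ⟨fun v => s (G.connectedComponentMk v) v, fun v => hs1 _ _, ?_⟩
  intro u v huv hc
  have he : G.connectedComponentMk u = G.connectedComponentMk v :=
    SimpleGraph.ConnectedComponent.sound huv.reachable
  dsimp only
  rw [he]
  exact hs2 _ hc u he v rfl huv

/-- Functions on the bipartite components give signed functions on the vertices. -/
noncomputable def auxMap {V : Type*} (G : SimpleGraph V) (s : V → ℝ) :
    ({cpt : G.ConnectedComponent // (G.induce cpt.supp).Colorable 2} → ℝ) →ₗ[ℝ] (V → ℝ) where
  toFun f v := if h : (G.induce (G.connectedComponentMk v).supp).Colorable 2 then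
    s v * f ⟨G.connectedComponentMk v, h⟩ else 0
  map_add' f g := by
    ext v
    simp only [Pi.add_apply]
    split_ifs <;> ring
  map_smul' a f := by
    ext v
    simp only [Pi.smul_apply, smul_eq_mul, RingHom.id_apply]
    split_ifs <;> ring

lemma auxMap_apply {V : Type*} (G : SimpleGraph V) (s : V → ℝ)
    (f : {cpt : G.ConnectedComponent // (G.induce cpt.supp).Colorable 2} → ℝ) (v : V) :
    auxMap G s f v = if h : (G.induce (G.connectedComponentMk v).supp).Colorable 2 then
      s v * f ⟨G.connectedComponentMk v, h⟩ else 0 := rfl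

lemma aux_finrank {V : Type*} [Fintype V] [DecidableEq V] (G : SimpleGraph V) :
    Module.finrank ℝ ((Submodule.span ℝ (edgeVectors G)).dualAnnihilator.comap
      (dotProductEquiv ℝ V).toLinearMap) =
    Nat.card {cpt : G.ConnectedComponent // (G.induce cpt.supp).Colorable 2} := by
  obtain ⟨s, hs1, hs2⟩ := aux_sign G
  have hs0 : ∀ v, s v ≠ 0 := fun v h => by simpa [h] using hs1 v
  have hinj : Function.Injective (auxMap G s) := by
    intro f g hfg
    ext ⟨c, hc⟩
    induction c using SimpleGraph.ConnectedComponent.ind with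
    | h v =>
      have := congrFun hfg v
      rw [auxMap_apply, auxMap_apply, dif_pos hc, dif_pos hc] at this
      exact mul_left_cancel₀ (hs0 v) this
  have hrange : LinearMap.range (auxMap G s) =
      (Submodule.span ℝ (edgeVectors G)).dualAnnihilator.comap
        (dotProductEquiv ℝ V).toLinearMap := by
    ext x
    rw [aux_mem]
    constructor
    · rintro ⟨f, rfl⟩ u v huv
      have he : G.connectedComponentMk u = G.connectedComponentMk v :=
        SimpleGraph.ConnectedComponent.sound huv.reachable
      rw [auxMap_apply, auxMap_apply]
      by_cases h : (G.induce (G.connectedComponentMk v).supp).Colorable 2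
      · have h' : (G.induce (G.connectedComponentMk u).supp).Colorable 2 := by rw [he]; exact h
        have hf : f ⟨_, h'⟩ = f ⟨_, h⟩ := congrArg f (Subtype.ext he)
        rw [dif_pos h, dif_pos h', hs2 u v huv h, hf]; ring
      · have h' : ¬ (G.induce (G.connectedComponentMk u).supp).Colorable 2 := by rw [he]; exact h
        rw [dif_neg h, dif_neg h', add_zero]
    · intro hx
      refine ⟨fun c => s c.1.out * x c.1.out, ?_⟩
      ext v
      rw [auxMap_apply]
      split_ifs with h
      · have hr : G.Reachable (G.connectedComponentMk v).out v :=
          SimpleGraph.ConnectedComponent.exact (Quot.out_eq _)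
        have := aux_const G (fun u => s u * x u) (fun a b hab => by
          have h1 := hx a b hab
          have h2 : x a = - x b := by linarith
          by_cases hb : (G.induce (G.connectedComponentMk b).supp).Colorable 2
          · simp only [hs2 a b hab hb, h2]; ring
          · have hb0 : x b = 0 := by
              by_contra h0
              exact hb (aux_color G x hx b h0)
            simp [h2, hb0]) hr
        dsimp only at this ⊢
        rw [this, ← mul_assoc, hs1, one_mul]
      · by_contra h0
        exact h (aux_color G x hx v (fun h' => h0 h'.symm))
  rw [← hrange, LinearMap.finrank_range_of_inj hinj]
  rw [Module.finrank_fintype_fun_eq_card, Nat.card_eq_fintype_card]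

/-- For a simple graph `G` on a vertex set of size `n`, the dimension of the span of
`{ e_u + e_v : {u,v} ∈ E(G) }` in `ℝ^V` equals `n` minus the number of bipartite connected
components of `G` (isolated vertices counting as bipartite components). -/
theorem statement10 {V : Type*} [Fintype V] [DecidableEq V] (n : ℕ)
    (hcard : Fintype.card V = n) (G : SimpleGraph V) :
    Module.finrank ℝ (Submodule.span ℝ (edgeVectors G))
      = n - Nat.card {cpt : G.ConnectedComponent // (G.induce cpt.supp).Colorable 2} := by

  have h1 := Subspace.finrank_add_finrank_dualAnnihilator_eq
    (Submodule.span ℝ (edgeVectors G))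
  have h2 := aux_finrank G
  have h3 : Module.finrank ℝ ((Submodule.span ℝ (edgeVectors G)).dualAnnihilator.comap
      (dotProductEquiv ℝ V).toLinearMap) =
      Module.finrank ℝ (Submodule.span ℝ (edgeVectors G)).dualAnnihilator :=
    ((dotProductEquiv ℝ V).ofSubmodule' _).finrank_eq
  rw [Module.finrank_fintype_fun_eq_card, hcard] at h1
  omega
end

section
/- Let 𝒜 be a finite arrangement of affine hyperplanes in ℝⁿ. Then the number of chambers of 𝒜, i.e., the number of connected components of ℝⁿ ∖ ⋃_{H ∈ 𝒜} H, equals (−1)ⁿ χ_𝒜(−1). -/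
open scoped Classical


/-- The hyperplane arrangement 𝒥ₙ, encoded as a finite set of pairs
(normal vector, constant): `H_{ij} : x_i + x_j = 1` for `i < j`,
`x_i = 0`, and `x_i = 1`. -/
noncomputable def Jn (n : ℕ) : Finset ((Fin n → ℝ) × ℝ) :=
  (((Finset.univ : Finset (Fin n × Fin n)).filter fun p => p.1 < p.2).image
      fun p => ((fun k => if k = p.1 ∨ k = p.2 then (1 : ℝ) else 0), (1 : ℝ)))
  ∪ (Finset.univ.image fun i : Fin n => (Pi.single i (1 : ℝ), (0 : ℝ)))
  ∪ (Finset.univ.image fun i : Fin n => (Pi.single i (1 : ℝ), (1 : ℝ)))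

/-- A subarrangement is central if the corresponding hyperplanes have a common point. -/
def IsCentral {n : ℕ} (B : Finset ((Fin n → ℝ) × ℝ)) : Prop :=
  ∃ x : Fin n → ℝ, ∀ p ∈ B, ∑ i, p.1 i * x i = p.2

/-- The rank of a subarrangement: dimension of the span of the normal vectors. -/
noncomputable def arrRank {n : ℕ} (B : Finset ((Fin n → ℝ) × ℝ)) : ℕ :=
  Module.finrank ℝ (Submodule.span ℝ (Prod.fst '' (B : Set ((Fin n → ℝ) × ℝ))))

/-- The characteristic polynomial `χ_𝒜(t) = Σ_ℬ (-1)^{|ℬ|} t^{n - rank ℬ}`,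
sum over central subarrangements ℬ of 𝒜. -/
noncomputable def charPoly {n : ℕ} (𝒜 : Finset ((Fin n → ℝ) × ℝ)) : Polynomial ℤ :=
  ∑ B ∈ 𝒜.powerset.filter (fun B => IsCentral B),
    (-1) ^ B.card * Polynomial.X ^ (n - arrRank B)

/-- The complement of the union of the hyperplanes of 𝒜. -/
def hypComplement {n : ℕ} (𝒜 : Finset ((Fin n → ℝ) × ℝ)) : Set (Fin n → ℝ) :=
  {x | ∀ p ∈ 𝒜, ∑ i, p.1 i * x i ≠ p.2}

/-- The chambers of 𝒜: connected components of the complement of the hyperplanes. -/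
def chambers {n : ℕ} (𝒜 : Finset ((Fin n → ℝ) × ℝ)) : Set (Set (Fin n → ℝ)) :=
  {C | ∃ x ∈ hypComplement 𝒜, C = connectedComponentIn (hypComplement 𝒜) x}

namespace Zas

abbrev H (n : ℕ) := (Fin n → ℝ) × ℝ

/-- value of the affine form at a point -/
def val {n : ℕ} (p : H n) (x : Fin n → ℝ) : ℝ := ∑ i, p.1 i * x i - p.2

/-- the common zero set of `C` -/
def Z {n : ℕ} (C : Finset (H n)) (x : Fin n → ℝ) : Prop := ∀ q ∈ C, ∑ i, q.1 i * x i = q.2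

/-- sign condition -/
def R {n : ℕ} (A S : Finset (H n)) (x : Fin n → ℝ) : Prop :=
  ∀ q ∈ A, (q ∈ S → 0 < val q x) ∧ (q ∉ S → val q x < 0)

/-- number of realized sign vectors -/
noncomputable def r {n : ℕ} (C A : Finset (H n)) : ℤ :=
  ∑ S ∈ A.powerset, if ∃ x, Z C x ∧ R A S x then 1 else 0

noncomputable def g {n : ℕ} (C A : Finset (H n)) : ℤ :=
  ∑ B ∈ A.powerset, if IsCentral (C ∪ B) then (-1) ^ (B.card + arrRank (C ∪ B)) else 0

variable {n : ℕ}

lemma val_line (p : H n) (x v : Fin n → ℝ) (t : ℝ) :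
    val p (x + t • v) = val p x + t * ∑ i, p.1 i * v i := by
  simp only [val, Pi.add_apply, Pi.smul_apply, smul_eq_mul, mul_add, Finset.sum_add_distrib,
    Finset.mul_sum]
  have : ∑ i, p.1 i * (t * v i) = ∑ i, t * (p.1 i * v i) :=
    Finset.sum_congr rfl fun i _ => by ring
  rw [this]; ring

lemma val_comb (p : H n) (x y : Fin n → ℝ) (a b : ℝ) (h : a + b = 1) :
    val p (a • x + b • y) = a * val p x + b * val p y := by
  have hb : b = 1 - a := by linarith
  subst hb
  simp only [val, Pi.add_apply, Pi.smul_apply, smul_eq_mul, mul_add, Finset.sum_add_distrib,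
    Finset.mul_sum, mul_sub]
  have h1 : ∑ i, p.1 i * (a * x i) = ∑ i, a * (p.1 i * x i) :=
    Finset.sum_congr rfl fun i _ => by ring
  have h2 : ∑ i, p.1 i * ((1 - a) * y i) = ∑ i, (1 - a) * (p.1 i * y i) :=
    Finset.sum_congr rfl fun i _ => by ring
  rw [h1, h2]; ring

lemma Z_iff (C : Finset (H n)) (x) : Z C x ↔ ∀ q ∈ C, val q x = 0 := by
  simp [Z, val, sub_eq_zero]

lemma val_cont (p : H n) : Continuous (val p) := by
  unfold val; fun_prop

lemma R_comb {A S : Finset (H n)} {x y : Fin n → ℝ} (hx : R A S x) (hy : R A S y) {a b : ℝ}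
    (ha : 0 ≤ a) (hb : 0 ≤ b) (h : a + b = 1) : R A S (a • x + b • y) := by
  intro q hq
  rw [val_comb q x y a b h]
  rcases ha.lt_or_eq with ha | ha
  · refine ⟨fun hs => ?_, fun hs => ?_⟩
    · have := (hx q hq).1 hs
      have := (hy q hq).1 hs
      positivity
    · have h1 := (hx q hq).2 hs
      have h2 := (hy q hq).2 hs
      nlinarith
  · have : b = 1 := by linarith
    subst this; subst ha
    simpa using hy q hq

lemma R_insert {A S : Finset (H n)} {p : H n} (hp : p ∉ A) (hS : S ⊆ A) (x) :
    (R (insert p A) S x ↔ R A S x ∧ val p x < 0) ∧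
    (R (insert p A) (insert p S) x ↔ R A S x ∧ 0 < val p x) := by
  have hpS : p ∉ S := fun h => hp (hS h)
  constructor
  · simp only [R, Finset.forall_mem_insert]
    tauto
  · unfold R
    rw [Finset.forall_mem_insert]
    simp only [Finset.mem_insert]
    constructor
    · rintro ⟨h1, h2⟩
      refine ⟨fun q hq => ?_, h1.1 (by simp)⟩
      have hne : q ≠ p := fun h => hp (h ▸ hq)
      have := h2 q hq
      simpa [hne] using this
    · rintro ⟨h1, h2⟩
      refine ⟨by simp [h2], fun q hq => ?_⟩
      have hne : q ≠ p := fun h => hp (h ▸ hq)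
      simpa [hne] using h1 q hq

lemma Z_insert (C : Finset (H n)) (p : H n) (x) : Z (insert p C) x ↔ Z C x ∧ val p x = 0 := by
  simp [Z_iff, and_comm]

lemma g_insert (C A : Finset (H n)) (p : H n) (hp : p ∉ A) :
    g C (insert p A) = g C A - g (insert p C) A := by
  unfold g
  rw [Finset.sum_powerset_insert hp, sub_eq_add_neg, ← Finset.sum_neg_distrib]
  congr 1
  refine Finset.sum_congr rfl fun B hB => ?_
  have hpB : p ∉ B := fun h => hp (Finset.mem_powerset.1 hB h)
  have : C ∪ insert p B = insert p C ∪ B := by ext; simp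
  rw [this, Finset.card_insert_of_notMem hpB]
  split_ifs
  · ring
  · simp

lemma r_insert (C A : Finset (H n)) (p : H n) (hp : p ∉ A) :
    r C (insert p A) = ∑ S ∈ A.powerset, ((if ∃ x, Z C x ∧ R A S x ∧ val p x < 0 then 1 else 0)
      + (if ∃ x, Z C x ∧ R A S x ∧ 0 < val p x then 1 else 0)) := by
  unfold r
  rw [Finset.sum_powerset_insert hp, ← Finset.sum_add_distrib]
  refine Finset.sum_congr rfl fun S hS => ?_
  have h := R_insert hp (Finset.mem_powerset.1 hS)
  simp only [(h _).1, (h _).2]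

lemma perturb {A S : Finset (H n)} {x : Fin n → ℝ} (hx : R A S x) (v : Fin n → ℝ) :
    ∃ ε > (0 : ℝ), R A S (x + ε • v) ∧ R A S (x + (-ε) • v) := by
  have key : ∀ᶠ t in nhds (0 : ℝ), R A S (x + t • v) := by
    unfold R
    rw [Filter.eventually_all_finset]
    intro q hq
    have hc : Continuous fun t : ℝ => val q (x + t • v) :=
      (val_cont q).comp (by fun_prop)
    have h0 : val q (x + (0 : ℝ) • v) = val q x := by simp
    by_cases hs : q ∈ S
    · have h1 := (hx q hq).1 hs
      rw [← h0] at h1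
      filter_upwards [hc.continuousAt.eventually (lt_mem_nhds h1)] with t ht
      exact ⟨fun _ => ht, fun h => absurd hs h⟩
    · have h1 := (hx q hq).2 hs
      rw [← h0] at h1
      filter_upwards [hc.continuousAt.eventually (gt_mem_nhds h1)] with t ht
      exact ⟨fun h => absurd h hs, fun _ => ht⟩
  obtain ⟨e, he, h⟩ := Metric.eventually_nhds_iff.1 key
  refine ⟨e / 2, by positivity, h ?_, h ?_⟩
  · simp [abs_of_pos he]; linarith
  · simp [abs_of_pos he]; linarith

abbrev sp (C : Finset (H n)) : Submodule ℝ (Fin n → ℝ) :=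
  Submodule.span ℝ (Prod.fst '' (C : Set (H n)))

lemma sp_insert (C : Finset (H n)) (p : H n) : sp (insert p C) = Submodule.span ℝ {p.1} ⊔ sp C := by
  simp [sp, Set.image_insert_eq, Submodule.span_insert]

lemma rank_mem {C : Finset (H n)} {p : H n} (h : p.1 ∈ sp C) : arrRank (insert p C) = arrRank C := by
  have : sp (insert p C) = sp C := by
    rw [sp_insert]; simpa using h
  simp only [arrRank]; exact congrArg (fun W : Submodule ℝ (Fin n → ℝ) => Module.finrank ℝ W) this

lemma rank_notMem {C : Finset (H n)} {p : H n} (h : p.1 ∉ sp C) :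
    arrRank (insert p C) = arrRank C + 1 := by
  have h1 := sp_insert C p
  have hp : p.1 ≠ 0 := fun h0 => h (h0 ▸ (sp C).zero_mem)
  have hd : Disjoint (Submodule.span ℝ {p.1}) (sp C) := by
    rw [disjoint_comm]; exact (Submodule.disjoint_span_singleton' hp).2 h
  have h2 := Submodule.finrank_sup_add_finrank_inf_eq (Submodule.span ℝ {p.1}) (sp C)
  rw [hd.eq_bot, finrank_bot, finrank_span_singleton hp, ← h1] at h2
  simp only [arrRank]
  change Module.finrank ℝ (sp (insert p C)) = Module.finrank ℝ (sp C) + 1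
  omega

lemma const_of_mem {C : Finset (H n)} {p : H n} (h : p.1 ∈ sp C) {x y : Fin n → ℝ}
    (hx : Z C x) (hy : Z C y) : val p x = val p y := by
  have key : ∀ w ∈ sp C, ∑ i, w i * (x i - y i) = 0 := by
    intro w hw
    induction hw using Submodule.span_induction with
    | mem w hw =>
      obtain ⟨q, hq, rfl⟩ := hw
      simp [mul_sub, hx q hq, hy q hq]
    | zero => simp
    | add a b _ _ ha hb => simp [add_mul, Finset.sum_add_distrib, ha, hb]
    | smul c a _ ha => simp [mul_assoc, ← Finset.mul_sum, ha]
  have := key _ h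
  simp only [mul_sub, Finset.sum_sub_distrib] at this
  simp only [val]; linarith

lemma exists_dir {C : Finset (H n)} {p : H n} (h : p.1 ∉ sp C) :
    ∃ v : Fin n → ℝ, (∀ q ∈ C, ∑ i, q.1 i * v i = 0) ∧ 0 < ∑ i, p.1 i * v i := by
  obtain ⟨f, hf, hle⟩ := Submodule.exists_le_ker_of_notMem h
  have hrep : ∀ w, f w = ∑ i, w i * f (Pi.single i 1) := fun w => by
    rw [LinearMap.pi_apply_eq_sum_univ f w]
    refine Finset.sum_congr rfl fun i _ => ?_
    rw [smul_eq_mul]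
    congr 2
    ext j; simp [Pi.single_apply, eq_comm]
  have hC : ∀ q ∈ C, f q.1 = 0 := fun q hq =>
    hle (Submodule.subset_span ⟨q, hq, rfl⟩)
  rcases lt_or_gt_of_ne hf with h0 | h0
  · refine ⟨fun i => - f (Pi.single i 1), fun q hq => ?_, ?_⟩
    · simp [← hrep, hC q hq]
    · simp [← hrep, h0]
  · exact ⟨fun i => f (Pi.single i 1), fun q hq => by rw [← hrep, hC q hq], by rwa [← hrep]⟩

lemma r_notMem {C A : Finset (H n)} {p : H n} (hp : p ∉ A) (h : p.1 ∉ sp C) :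
    r C (insert p A) = r C A + r (insert p C) A := by
  rw [r_insert C A p hp]
  unfold r
  rw [← Finset.sum_add_distrib]
  refine Finset.sum_congr rfl fun S _ => ?_
  obtain ⟨v, hv, hpv⟩ := exists_dir h
  have hZv : ∀ x t, Z C x → Z C (x + t • v) := fun x t hx => by
    rw [Z_iff] at *
    intro q hq
    rw [val_line, hx q hq, hv q hq]; simp
  have h01 : (∃ x, Z (insert p C) x ∧ R A S x) →
      (∃ x, Z C x ∧ R A S x ∧ val p x < 0) ∧ (∃ x, Z C x ∧ R A S x ∧ 0 < val p x) := by
    rintro ⟨x, hx, hR⟩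
    rw [Z_insert] at hx
    obtain ⟨e, he, h1, h2⟩ := perturb hR v
    refine ⟨⟨_, hZv _ _ hx.1, h2, ?_⟩, ⟨_, hZv _ _ hx.1, h1, ?_⟩⟩
    · rw [val_line, hx.2]; nlinarith
    · rw [val_line, hx.2]; nlinarith
  have h10 : (∃ x, Z C x ∧ R A S x ∧ val p x < 0) → (∃ x, Z C x ∧ R A S x ∧ 0 < val p x) →
      (∃ x, Z (insert p C) x ∧ R A S x) := by
    rintro ⟨x, hx, hxR, hxp⟩ ⟨y, hy, hyR, hyp⟩
    have hd : 0 < val p y - val p x := by linarith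
    have hs : val p y / (val p y - val p x) + (- val p x) / (val p y - val p x) = 1 := by
      field_simp; ring
    refine ⟨(val p y / (val p y - val p x)) • x + ((- val p x) / (val p y - val p x)) • y,
      ?_, R_comb hxR hyR (by positivity) (div_nonneg (by linarith) hd.le) hs⟩
    rw [Z_insert, val_comb _ _ _ _ _ hs, Z_iff]
    rw [Z_iff] at hx hy
    refine ⟨fun q hq => ?_, by field_simp; ring⟩
    rw [val_comb _ _ _ _ _ hs, hx q hq, hy q hq]; simp
  have hall : (∃ x, Z C x ∧ R A S x) ↔ ((∃ x, Z C x ∧ R A S x ∧ val p x < 0) ∨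
      (∃ x, Z C x ∧ R A S x ∧ 0 < val p x)) := by
    constructor
    · rintro ⟨x, hx, hR⟩
      rcases lt_trichotomy (val p x) 0 with h0 | h0 | h0
      · exact Or.inl ⟨x, hx, hR, h0⟩
      · exact Or.inl (h01 ⟨x, (Z_insert _ _ _).2 ⟨hx, h0⟩, hR⟩).1
      · exact Or.inr ⟨x, hx, hR, h0⟩
    · rintro (⟨x, hx, hR, _⟩ | ⟨x, hx, hR, _⟩) <;> exact ⟨x, hx, hR⟩
  generalize (∃ x, Z C x ∧ R A S x ∧ val p x < 0) = a at *
  generalize (∃ x, Z C x ∧ R A S x ∧ 0 < val p x) = b at *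
  generalize (∃ x, Z C x ∧ R A S x) = c at *
  generalize (∃ x, Z (insert p C) x ∧ R A S x) = d at *
  by_cases a <;> by_cases b <;> by_cases d <;> simp_all

lemma r_mem {C A : Finset (H n)} {p : H n} (hp : p ∉ A) (h : p.1 ∈ sp C) :
    r C (insert p A) = r C A - r (insert p C) A := by
  rw [r_insert C A p hp]
  unfold r
  rw [← Finset.sum_sub_distrib]
  refine Finset.sum_congr rfl fun S _ => ?_
  simp only [Z_insert]
  by_cases hc : ∃ x, Z C x ∧ R A S x
  · obtain ⟨x, hx, hR⟩ := hc
    have hv : ∀ y, Z C y → val p y = val p x := fun y hy => const_of_mem h hy hx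
    have e1 : (∃ y, Z C y ∧ R A S y ∧ val p y < 0) ↔ val p x < 0 :=
      ⟨fun ⟨y, hy, _, h0⟩ => hv y hy ▸ h0, fun h0 => ⟨x, hx, hR, h0⟩⟩
    have e2 : (∃ y, Z C y ∧ R A S y ∧ 0 < val p y) ↔ 0 < val p x :=
      ⟨fun ⟨y, hy, _, h0⟩ => hv y hy ▸ h0, fun h0 => ⟨x, hx, hR, h0⟩⟩
    have e3 : (∃ y, (Z C y ∧ val p y = 0) ∧ R A S y) ↔ val p x = 0 :=
      ⟨fun ⟨y, ⟨hy, h0⟩, _⟩ => hv y hy ▸ h0, fun h0 => ⟨x, ⟨hx, h0⟩, hR⟩⟩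
    have e4 : (∃ y, Z C y ∧ R A S y) ↔ True := by simpa using ⟨x, hx, hR⟩
    simp only [e1, e2, e3, e4]
    rcases lt_trichotomy (val p x) 0 with h0 | h0 | h0
    · simp [h0, h0.ne, h0.le]
    · simp [h0]
    · simp [h0, h0.ne', h0.le]
  · have e1 : ¬ (∃ y, Z C y ∧ R A S y ∧ val p y < 0) := fun ⟨y, a, b, _⟩ => hc ⟨y, a, b⟩
    have e2 : ¬ (∃ y, Z C y ∧ R A S y ∧ 0 < val p y) := fun ⟨y, a, b, _⟩ => hc ⟨y, a, b⟩
    have e3 : ¬ (∃ y, (Z C y ∧ val p y = 0) ∧ R A S y) := fun ⟨y, a, b⟩ => hc ⟨y, a.1, b⟩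
    simp only [e1, e2, e3, hc, if_false]; simp

theorem r_eq_g (A : Finset (H n)) : ∀ C : Finset (H n), r C A = (-1) ^ arrRank C * g C A := by
  induction A using Finset.induction_on with
  | empty =>
    intro C
    have : (∃ x, Z C x) ↔ IsCentral C := Iff.rfl
    simp only [r, g, Finset.powerset_empty, Finset.sum_singleton, R, Finset.union_empty]
    by_cases h : IsCentral C
    · simp [this, h, ← pow_add, ← two_mul]
    · simp [this, h]
  | insert p A hp ih =>
    intro C
    rw [g_insert _ _ _ hp]
    by_cases h : p.1 ∈ sp C
    · rw [r_mem hp h, ih, ih, rank_mem h]; ring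
    · rw [r_notMem hp h, ih, ih, rank_notMem h]; ring

/-- the positive set of a point -/
noncomputable def pos (A : Finset (H n)) (x : Fin n → ℝ) : Finset (H n) :=
  A.filter fun q => 0 < val q x

lemma mem_compl (A : Finset (H n)) (x) : x ∈ hypComplement A ↔ ∀ q ∈ A, val q x ≠ 0 := by
  simp [hypComplement, val, sub_eq_zero]

lemma R_pos {A : Finset (H n)} {x} (hx : x ∈ hypComplement A) : R A (pos A x) x := by
  rw [mem_compl] at hx
  intro q hq
  refine ⟨fun h => (Finset.mem_filter.1 h).2, fun h => ?_⟩
  have : ¬ 0 < val q x := fun h0 => h (Finset.mem_filter.2 ⟨hq, h0⟩)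
  exact lt_of_le_of_ne (not_lt.1 this) (hx q hq)

lemma R_compl {A S : Finset (H n)} {x} (hx : R A S x) : x ∈ hypComplement A := by
  rw [mem_compl]
  intro q hq
  by_cases hs : q ∈ S
  · exact ((hx q hq).1 hs).ne'
  · exact ((hx q hq).2 hs).ne

lemma R_eq_pos {A S : Finset (H n)} (hS : S ⊆ A) {x} (hx : R A S x) : S = pos A x := by
  ext q
  simp only [pos, Finset.mem_filter]
  constructor
  · exact fun h => ⟨hS h, (hx q (hS h)).1 h⟩
  · rintro ⟨hq, h⟩
    by_contra hs
    exact absurd ((hx q hq).2 hs) h.not_gt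

lemma comp_eq {A S : Finset (H n)} {x} (hx : R A S x) :
    connectedComponentIn (hypComplement A) x = {y | R A S y} := by
  apply Set.Subset.antisymm
  · intro y hy q hq
    have hpre : IsPreconnected (val q '' connectedComponentIn (hypComplement A) x) :=
      isPreconnected_connectedComponentIn.image _ (val_cont q).continuousOn
    have hxm : x ∈ connectedComponentIn (hypComplement A) x :=
      mem_connectedComponentIn (R_compl hx)
    have h0 : (0 : ℝ) ∉ val q '' connectedComponentIn (hypComplement A) x := by
      rintro ⟨z, hz, hz0⟩
      exact (mem_compl A z).1 (connectedComponentIn_subset _ _ hz) q hq hz0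
    have ho := hpre.ordConnected
    refine ⟨fun hs => ?_, fun hs => ?_⟩
    · by_contra hc
      exact h0 (ho.out ⟨y, hy, rfl⟩ ⟨x, hxm, rfl⟩ ⟨not_lt.1 hc, ((hx q hq).1 hs).le⟩)
    · by_contra hc
      exact h0 (ho.out ⟨x, hxm, rfl⟩ ⟨y, hy, rfl⟩ ⟨((hx q hq).2 hs).le, not_lt.1 hc⟩)
  · apply IsPreconnected.subset_connectedComponentIn
    · apply Convex.isPreconnected
      intro a ha b hb s t hs ht hst
      exact R_comb ha hb hs ht hst
    · exact hx
    · exact fun y hy => R_compl hy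

theorem chambers_card (A : Finset (H n)) : ((chambers A).ncard : ℤ) = r ∅ A := by
  have himg : chambers A = (fun S => {y | R A S y}) ''
      ((A.powerset.filter fun S => ∃ x, R A S x : Finset (Finset (H n))) : Set (Finset (H n))) := by
    ext K
    simp only [chambers, Set.mem_ofPred_eq, Set.mem_image, Finset.coe_filter, Finset.mem_powerset]
    constructor
    · rintro ⟨x, hx, rfl⟩
      exact ⟨pos A x, ⟨Finset.filter_subset _ _, x, R_pos hx⟩, (comp_eq (R_pos hx)).symm⟩
    · rintro ⟨S, ⟨_, x, hx⟩, rfl⟩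
      exact ⟨x, R_compl hx, (comp_eq hx).symm⟩
  rw [himg, Set.ncard_image_of_injOn, Set.ncard_coe_finset, r, Finset.card_filter]
  · push_cast
    simp [Z]
  · intro S hS T hT hST
    simp only [Finset.coe_filter, Finset.mem_powerset, Set.mem_ofPred_eq] at hS hT
    obtain ⟨hSA, x, hx⟩ := hS
    have hxT : x ∈ {y | R A T y} := (Set.ext_iff.1 hST x).1 hx
    rw [R_eq_pos hSA hx, R_eq_pos hT.1 hxT]

end Zas

/-- Zaslavsky's theorem: the number of chambers of a finite affine hyperplane arrangement
`𝒜` in `ℝⁿ` equals `(−1)ⁿ χ_𝒜(−1)`. -/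
theorem statement16 (n : ℕ) (𝒜 : Finset ((Fin n → ℝ) × ℝ))
    (hnz : ∀ p ∈ 𝒜, p.1 ≠ 0)
    (hinj : ∀ p ∈ 𝒜, ∀ q ∈ 𝒜,
      {x : Fin n → ℝ | ∑ i, p.1 i * x i = p.2} = {x : Fin n → ℝ | ∑ i, q.1 i * x i = q.2}
        → p = q) :
    ((chambers 𝒜).ncard : ℤ) = (-1) ^ n * (charPoly 𝒜).eval (-1) := by
  rw [Zas.chambers_card, Zas.r_eq_g]
  have h0 : arrRank (∅ : Finset ((Fin n → ℝ) × ℝ)) = 0 := by simp [arrRank]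
  rw [h0, pow_zero, one_mul, Zas.g, charPoly, Polynomial.eval_finset_sum, Finset.mul_sum,
    Finset.sum_filter]
  refine Finset.sum_congr rfl fun B _ => ?_
  rw [Finset.empty_union]
  split_ifs
  · have hle : arrRank B ≤ n := by
      have := Submodule.finrank_le (Submodule.span ℝ (Prod.fst '' (B : Set ((Fin n → ℝ) × ℝ))))
      simpa [arrRank] using this
    obtain ⟨k, hk⟩ := Nat.exists_eq_add_of_le hle
    have hk' : n - arrRank B = k := by omega
    rw [hk']
    simp only [Polynomial.eval_mul, Polynomial.eval_pow, Polynomial.eval_neg, Polynomial.eval_one,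
      Polynomial.eval_X]
    have h2 : ((-1 : ℤ) ^ n) = (-1) ^ arrRank B * (-1) ^ k := by rw [← pow_add, ← hk]
    have h3 : ((-1 : ℤ) ^ k) * (-1) ^ k = 1 := by rw [← mul_pow]; simp
    rw [h2, pow_add]
    linear_combination (-(-1 : ℤ) ^ B.card * (-1) ^ arrRank B) * h3
  · rfl
end

section
/- Let 𝒜 be a finite arrangement of affine hyperplanes in ℝⁿ whose rank is n (i.e., the normal vectors of the hyperplanes of 𝒜 span ℝⁿ). Then the number of bounded chambers of 𝒜, i.e., the number of bounded connected components of ℝⁿ ∖ ⋃_{H ∈ 𝒜} H, equals (−1)ⁿ χ_𝒜(1). -/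
open scoped Classical


section Zas

variable {V : Type*} [AddCommGroup V] [Module ℝ V] {ι : Type*}

/-- Key counting lemma, generic case. -/
lemma zas_caseB (R K : Set V) (N : V → Prop) (φ : V →ₗ[ℝ] ℝ) (γ : ℝ)
    (hconv : Convex ℝ R)
    (hrec : ∀ x ∈ R, ∀ v ∈ K, ∀ t : ℝ, 0 ≤ t → x + t • v ∈ R)
    (hK : ∀ u ∈ K, ∀ v ∈ K, ∀ s t : ℝ, 0 ≤ s → 0 ≤ t → s • u + t • v ∈ K)
    (hN : ∀ u ∈ K, ∀ v ∈ K, ∀ s t : ℝ, 0 < s → 0 < t → N (s • u + t • v) → N u)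
    (hNφ : ∀ v ∈ K, N v → φ v = 0)
    (hopen : ∀ x ∈ R, ∃ w, 0 < φ w ∧ x + w ∈ R ∧ x - w ∈ R) :
    ((if (∃ x ∈ R, φ x < γ) ∧ ∀ v ∈ K, φ v ≤ 0 → (N v ∧ φ v = 0) then 1 else 0) : ℤ)
      + (if (∃ x ∈ R, γ < φ x) ∧ ∀ v ∈ K, 0 ≤ φ v → (N v ∧ φ v = 0) then 1 else 0)
    = (if (∃ x, x ∈ R) ∧ ∀ v ∈ K, N v then 1 else 0)
      + (if (∃ x ∈ R, φ x = γ) ∧ ∀ v ∈ K, φ v = 0 → N v then 1 else 0) := by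
  have e1 : (∀ v ∈ K, φ v ≤ 0 → (N v ∧ φ v = 0)) ↔ (∀ v ∈ K, φ v ≤ 0 → N v) :=
    ⟨fun h v hv h2 => (h v hv h2).1, fun h v hv h2 => ⟨h v hv h2, hNφ v hv (h v hv h2)⟩⟩
  have e2 : (∀ v ∈ K, 0 ≤ φ v → (N v ∧ φ v = 0)) ↔ (∀ v ∈ K, 0 ≤ φ v → N v) :=
    ⟨fun h v hv h2 => (h v hv h2).1, fun h v hv h2 => ⟨h v hv h2, hNφ v hv (h v hv h2)⟩⟩
  rw [e1, e2]
  by_cases h0 : ∃ x ∈ R, φ x = γ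
  · obtain ⟨x, hx, hxγ⟩ := h0
    obtain ⟨w, hw, h1, h2⟩ := hopen x hx
    have n1 : ∃ x ∈ R, φ x < γ := ⟨x - w, h2, by rw [map_sub]; linarith⟩
    have n2 : ∃ x ∈ R, γ < φ x := ⟨x + w, h1, by rw [map_add]; linarith⟩
    have n3 : ∃ x, x ∈ R := ⟨x, hx⟩
    have n4 : ∃ x ∈ R, φ x = γ := ⟨x, hx, hxγ⟩
    simp only [n1, n2, n3, n4, true_and]
    have key : (∀ v ∈ K, φ v = 0 → N v) → (∀ v ∈ K, φ v ≤ 0 → N v) ∨ (∀ v ∈ K, 0 ≤ φ v → N v) := by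
      intro h
      by_contra! hc
      obtain ⟨⟨u, hu, hu1, hu2⟩, ⟨v, hv, hv1, hv2⟩⟩ := hc
      have hu3 : φ u < 0 := lt_of_le_of_ne hu1 (fun h' => hu2 (h u hu h'))
      have hv3 : 0 < φ v := lt_of_le_of_ne hv1 (fun h' => hv2 (h v hv h'.symm))
      apply hu2
      apply hN u hu v hv (φ v) (-φ u) hv3 (by linarith)
      apply h _ (hK u hu v hv _ _ hv3.le (by linarith))
      simp only [map_add, map_smul, smul_eq_mul]; ring
    have hall : (∀ v ∈ K, N v) ↔ (∀ v ∈ K, φ v ≤ 0 → N v) ∧ (∀ v ∈ K, 0 ≤ φ v → N v) :=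
      ⟨fun h => ⟨fun v hv _ => h v hv, fun v hv _ => h v hv⟩,
        fun h v hv => (le_total (φ v) 0).elim (h.1 v hv) (h.2 v hv)⟩
    have hz1 : (∀ v ∈ K, φ v ≤ 0 → N v) → (∀ v ∈ K, φ v = 0 → N v) :=
      fun h v hv h' => h v hv h'.le
    have hz2 : (∀ v ∈ K, 0 ≤ φ v → N v) → (∀ v ∈ K, φ v = 0 → N v) :=
      fun h v hv h' => h v hv h'.ge
    rw [hall]
    clear hall
    generalize (∀ v ∈ K, φ v ≤ 0 → N v) = A1 at *
    generalize (∀ v ∈ K, 0 ≤ φ v → N v) = A2 at *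
    generalize (∀ v ∈ K, φ v = 0 → N v) = A3 at *
    split_ifs <;> first | rfl | (exfalso; tauto)
  · have h0' : ¬ ((∃ x ∈ R, φ x = γ) ∧ ∀ v ∈ K, φ v = 0 → N v) := fun h => h0 h.1
    rw [if_neg h0']
    by_cases hR : ∃ x, x ∈ R
    swap
    · have g1 : ¬ ∃ x ∈ R, φ x < γ := fun ⟨x, hx, _⟩ => hR ⟨x, hx⟩
      have g2 : ¬ ∃ x ∈ R, γ < φ x := fun ⟨x, hx, _⟩ => hR ⟨x, hx⟩
      simp only [g1, g2, hR, false_and, if_false]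
    have noboth : ∀ x ∈ R, ∀ y ∈ R, φ x < γ → γ < φ y → False := by
      intro x hx y hy h1 h2
      apply h0
      have hd : 0 < φ y - φ x := by linarith
      refine ⟨((φ y - γ) / (φ y - φ x)) • x + ((γ - φ x) / (φ y - φ x)) • y, ?_, ?_⟩
      · apply hconv hx hy
        · apply div_nonneg <;> linarith
        · apply div_nonneg <;> linarith
        · field_simp; ring
      · simp only [map_add, map_smul, smul_eq_mul]; field_simp; ring
    obtain ⟨x, hx⟩ := hR
    have n3 : ∃ x, x ∈ R := ⟨x, hx⟩
    rcases lt_trichotomy (φ x) γ with h | h | h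
    · have g1 : ∃ x ∈ R, φ x < γ := ⟨x, hx, h⟩
      have g2 : ¬ ∃ x ∈ R, γ < φ x := fun ⟨y, hy, h'⟩ => noboth x hx y hy h h'
      have hle : ∀ v ∈ K, φ v ≤ 0 := by
        intro v hv
        by_contra! hc
        apply g2
        refine ⟨_, hrec x hx v hv ((γ - φ x) / φ v + 1) ?_, ?_⟩
        · have : 0 < γ - φ x := by linarith
          positivity
        · simp only [map_add, map_smul, smul_eq_mul]; field_simp; linarith
      have : (∀ v ∈ K, φ v ≤ 0 → N v) ↔ ∀ v ∈ K, N v :=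
        ⟨fun h v hv => h v hv (hle v hv), fun h v hv _ => h v hv⟩
      simp only [g1, g2, n3, this, true_and, false_and, if_false]
    · exact absurd ⟨x, hx, h⟩ h0
    · have g1 : ∃ x ∈ R, γ < φ x := ⟨x, hx, h⟩
      have g2 : ¬ ∃ x ∈ R, φ x < γ := fun ⟨y, hy, h'⟩ => noboth y hy x hx h' h
      have hle : ∀ v ∈ K, 0 ≤ φ v := by
        intro v hv
        by_contra! hc
        apply g2
        have hm : 0 < - φ v := by linarith
        refine ⟨_, hrec x hx v hv ((φ x - γ) / (-φ v) + 1) ?_, ?_⟩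
        · have : 0 < φ x - γ := by linarith
          positivity
        · simp only [map_add, map_smul, smul_eq_mul]
          have : (φ x - γ) / (-φ v) * (-φ v) = φ x - γ := div_mul_cancel₀ _ hm.ne'
          nlinarith
      have : (∀ v ∈ K, 0 ≤ φ v → N v) ↔ ∀ v ∈ K, N v :=
        ⟨fun h v hv => h v hv (hle v hv), fun h v hv _ => h v hv⟩
      simp only [g1, g2, n3, this, true_and, false_and, if_false, zero_add, add_zero]

/-- Key counting lemma, the functional is constant. -/
lemma zas_caseA (R K : Set V) (N : V → Prop) (φ : V →ₗ[ℝ] ℝ) (γ : ℝ)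
    (hφK : ∀ v ∈ K, φ v = 0)
    (hconst : ∀ x ∈ R, ∀ y ∈ R, φ x = φ y) :
    ((if (∃ x ∈ R, φ x < γ) ∧ ∀ v ∈ K, φ v ≤ 0 → (N v ∧ φ v = 0) then 1 else 0) : ℤ)
      + (if (∃ x ∈ R, γ < φ x) ∧ ∀ v ∈ K, 0 ≤ φ v → (N v ∧ φ v = 0) then 1 else 0)
    = (if (∃ x, x ∈ R) ∧ ∀ v ∈ K, N v then 1 else 0)
      - (if (∃ x ∈ R, φ x = γ) ∧ ∀ v ∈ K, φ v = 0 → N v then 1 else 0) := by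
  have e1 : (∀ v ∈ K, φ v ≤ 0 → (N v ∧ φ v = 0)) ↔ (∀ v ∈ K, N v) :=
    ⟨fun h v hv => (h v hv (hφK v hv).le).1, fun h v hv _ => ⟨h v hv, hφK v hv⟩⟩
  have e2 : (∀ v ∈ K, 0 ≤ φ v → (N v ∧ φ v = 0)) ↔ (∀ v ∈ K, N v) :=
    ⟨fun h v hv => (h v hv (hφK v hv).ge).1, fun h v hv _ => ⟨h v hv, hφK v hv⟩⟩
  have e3 : (∀ v ∈ K, φ v = 0 → N v) ↔ (∀ v ∈ K, N v) :=
    ⟨fun h v hv => h v hv (hφK v hv), fun h v hv _ => h v hv⟩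
  rw [e1, e2, e3]
  by_cases hR : ∃ x, x ∈ R
  swap
  · have g1 : ¬ ∃ x ∈ R, φ x < γ := fun ⟨x, hx, _⟩ => hR ⟨x, hx⟩
    have g2 : ¬ ∃ x ∈ R, γ < φ x := fun ⟨x, hx, _⟩ => hR ⟨x, hx⟩
    have g3 : ¬ ∃ x ∈ R, φ x = γ := fun ⟨x, hx, _⟩ => hR ⟨x, hx⟩
    simp only [g1, g2, g3, hR, false_and, if_false]; rfl
  obtain ⟨x, hx⟩ := hR
  have f0 : ∃ x, x ∈ R := ⟨x, hx⟩
  have f1 : (∃ y ∈ R, φ y < γ) ↔ φ x < γ :=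
    ⟨fun ⟨y, hy, h⟩ => by rwa [hconst x hx y hy], fun h => ⟨x, hx, h⟩⟩
  have f2 : (∃ y ∈ R, γ < φ y) ↔ γ < φ x :=
    ⟨fun ⟨y, hy, h⟩ => by rwa [hconst x hx y hy], fun h => ⟨x, hx, h⟩⟩
  have f3 : (∃ y ∈ R, φ y = γ) ↔ φ x = γ :=
    ⟨fun ⟨y, hy, h⟩ => by rwa [hconst x hx y hy], fun h => ⟨x, hx, h⟩⟩
  rw [f1, f2, f3]
  by_cases hall : ∀ v ∈ K, N v
  · rcases lt_trichotomy (φ x) γ with h | h | h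
    · simp [f0, h, h.not_gt, h.ne]
    · simp [f0, h]
    · simp [f0, h, h.not_gt, h.ne']
  · simp only [hall, and_false, if_false]; rfl

/-- Key counting lemma, independent case. -/
lemma zas_caseC (R K : Set V) (N : V → Prop) (φ : V →ₗ[ℝ] ℝ) (γ : ℝ) (w : V)
    (hw : φ w = 1) (hwK : w ∈ K) (hwK' : -w ∈ K)
    (hR : ∀ x ∈ R, ∀ t : ℝ, x + t • w ∈ R)
    (hK : ∀ x ∈ K, ∀ t : ℝ, x + t • w ∈ K)
    (hN : ∀ v, ∀ t : ℝ, N (v + t • w) → N v) :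
    ((if (∃ x ∈ R, φ x < γ) ∧ ∀ v ∈ K, φ v ≤ 0 → (N v ∧ φ v = 0) then 1 else 0) : ℤ)
      + (if (∃ x ∈ R, γ < φ x) ∧ ∀ v ∈ K, 0 ≤ φ v → (N v ∧ φ v = 0) then 1 else 0) = 0
    ∧ ((if (∃ x, x ∈ R) ∧ ∀ v ∈ K, N v then 1 else 0) : ℤ)
      = (if (∃ x ∈ R, φ x = γ) ∧ ∀ v ∈ K, φ v = 0 → N v then 1 else 0) := by
  constructor
  · rw [if_neg, if_neg]
    · rfl
    · rintro ⟨-, h⟩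
      have := (h w hwK (by rw [hw]; norm_num)).2
      rw [hw] at this; norm_num at this
    · rintro ⟨-, h⟩
      have := (h (-w) hwK' (by rw [map_neg, hw]; norm_num)).2
      rw [map_neg, hw] at this; norm_num at this
  · congr 1
    apply propext
    apply and_congr
    · constructor
      · rintro ⟨x, hx⟩
        exact ⟨_, hR x hx (γ - φ x), by simp [hw]⟩
      · rintro ⟨x, hx, -⟩; exact ⟨x, hx⟩
    · constructor
      · intro h v hv _; exact h v hv
      · intro h v hv
        apply hN v (-φ v)
        apply h _ (hK v hv _)
        simp [hw]

/-- Lineality space. -/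
def zL (a : ι → V →ₗ[ℝ] ℝ) (U : Finset ι) : Submodule ℝ V where
  carrier := {v | ∀ i ∈ U, a i v = 0}
  add_mem' := by
    intro x y hx hy i hi
    rw [map_add, hx i hi, hy i hi, add_zero]
  zero_mem' := by intro i _; exact map_zero _
  smul_mem' := by
    intro t x hx i hi
    rw [map_smul, hx i hi, smul_zero]

/-- Region of a sign vector. -/
def zR (a : ι → V →ₗ[ℝ] ℝ) (c : ι → ℝ) (T S P : Finset ι) : Set V :=
  {x | (∀ i ∈ T, a i x = c i) ∧ ∀ i ∈ S, (i ∈ P → c i < a i x) ∧ (i ∉ P → a i x < c i)}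

/-- Recession cone of a sign vector. -/
def zK (a : ι → V →ₗ[ℝ] ℝ) (T S P : Finset ι) : Set V :=
  {x | (∀ i ∈ T, a i x = 0) ∧ ∀ i ∈ S, (i ∈ P → 0 ≤ a i x) ∧ (i ∉ P → a i x ≤ 0)}

/-- The sign vector is that of a relatively bounded region. -/
def zG (a : ι → V →ₗ[ℝ] ℝ) (c : ι → ℝ) (T S P : Finset ι) : Prop :=
  (∃ x, x ∈ zR a c T S P) ∧ ∀ v ∈ zK a T S P, ∀ i ∈ S, a i v = 0

noncomputable def zb (a : ι → V →ₗ[ℝ] ℝ) (c : ι → ℝ) (T S : Finset ι) : ℤ :=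
  ∑ P ∈ S.powerset, if zG a c T S P then 1 else 0

def zCen (a : ι → V →ₗ[ℝ] ℝ) (c : ι → ℝ) (B : Finset ι) : Prop :=
  ∃ x, ∀ i ∈ B, a i x = c i

noncomputable def zchi (a : ι → V →ₗ[ℝ] ℝ) (c : ι → ℝ) (T S : Finset ι) : ℤ :=
  ∑ B ∈ S.powerset, if zCen a c (T ∪ B) then (-1) ^ B.card else 0

lemma z_empty_union (B : Finset ι) : ∅ ∪ B = B := Finset.empty_union B

lemma zchi_insert (a : ι → V →ₗ[ℝ] ℝ) (c : ι → ℝ) (T S : Finset ι) (h : ι) (hS : h ∉ S) :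
    zchi a c T (insert h S) = zchi a c T S - zchi a c (insert h T) S := by
  unfold zchi
  rw [Finset.sum_powerset_insert hS, sub_eq_add_neg, ← Finset.sum_neg_distrib]
  congr 1
  apply Finset.sum_congr rfl
  intro B hB
  have hB' : h ∉ B := fun h' => hS (Finset.mem_powerset.1 hB h')
  rw [Finset.card_insert_of_notMem hB', Finset.union_insert, Finset.insert_union]
  split_ifs
  · ring
  · rfl

lemma zb_insert (a : ι → V →ₗ[ℝ] ℝ) (c : ι → ℝ) (T S : Finset ι) (h : ι) (hS : h ∉ S) :
    zb a c T (insert h S) = ∑ P ∈ S.powerset,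
      ((if zG a c T (insert h S) P then 1 else 0) +
        (if zG a c T (insert h S) (insert h P) then 1 else 0)) := by
  unfold zb
  rw [Finset.sum_powerset_insert hS, ← Finset.sum_add_distrib]

lemma zG_neg (a : ι → V →ₗ[ℝ] ℝ) (c : ι → ℝ) (T S P : Finset ι) (h : ι) (hP : h ∉ P) :
    zG a c T (insert h S) P ↔ ((∃ x ∈ zR a c T S P, a h x < c h) ∧ ∀ v ∈ zK a T S P,
      a h v ≤ 0 → ((∀ i ∈ S, a i v = 0) ∧ a h v = 0)) := by
  unfold zG zR zK
  simp only [Finset.forall_mem_insert, Set.mem_ofPred_eq, hP]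
  grind

lemma zG_pos (a : ι → V →ₗ[ℝ] ℝ) (c : ι → ℝ) (T S P : Finset ι) (h : ι) (hS : h ∉ S) :
    zG a c T (insert h S) (insert h P) ↔ ((∃ x ∈ zR a c T S P, c h < a h x) ∧ ∀ v ∈ zK a T S P,
      0 ≤ a h v → ((∀ i ∈ S, a i v = 0) ∧ a h v = 0)) := by
  have hne : ∀ i ∈ S, (i ∈ insert h P ↔ i ∈ P) := by grind
  have e1 : ∀ x, x ∈ zR a c T (insert h S) (insert h P) ↔ x ∈ zR a c T S P ∧ c h < a h x := by
    intro x; unfold zR; simp only [Finset.forall_mem_insert, Set.mem_ofPred_eq]; grind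
  have e2 : ∀ x, x ∈ zK a T (insert h S) (insert h P) ↔ x ∈ zK a T S P ∧ 0 ≤ a h x := by
    intro x; unfold zK; simp only [Finset.forall_mem_insert, Set.mem_ofPred_eq]; grind
  unfold zG
  simp only [e1, e2, Finset.forall_mem_insert]
  grind

lemma zG_zero (a : ι → V →ₗ[ℝ] ℝ) (c : ι → ℝ) (T S P : Finset ι) (h : ι) :
    zG a c (insert h T) S P ↔ ((∃ x ∈ zR a c T S P, a h x = c h) ∧ ∀ v ∈ zK a T S P,
      a h v = 0 → (∀ i ∈ S, a i v = 0)) := by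
  unfold zG zR zK
  simp only [Finset.forall_mem_insert, Set.mem_ofPred_eq]
  grind

/-- Openness of regions in a direction. -/
lemma zR_open (a : ι → V →ₗ[ℝ] ℝ) (c : ι → ℝ) (T S P : Finset ι) (x : V) (hx : x ∈ zR a c T S P)
    (w : V) (hw : w ∈ zL a T) :
    ∃ ε : ℝ, 0 < ε ∧ x + ε • w ∈ zR a c T S P ∧ x - ε • w ∈ zR a c T S P := by
  have key : ∀ w ∈ zL a T, ∀ᶠ ε : ℝ in nhdsWithin 0 (Set.Ioi 0), x + ε • w ∈ zR a c T S P := by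
    intro w hw
    have : ∀ᶠ ε : ℝ in nhdsWithin 0 (Set.Ioi 0), ∀ i ∈ S,
        (i ∈ P → c i < a i (x + ε • w)) ∧ (i ∉ P → a i (x + ε • w) < c i) := by
      rw [Filter.eventually_all_finset]
      intro i hi
      have ht : Filter.Tendsto (fun ε : ℝ => a i (x + ε • w)) (nhdsWithin 0 (Set.Ioi 0))
          (nhds (a i x)) := by
        have : Continuous (fun ε : ℝ => a i (x + ε • w)) := by
          simp only [map_add, map_smul, smul_eq_mul]; fun_prop
        have h2 := this.tendsto 0
        simp only [zero_smul, add_zero] at h2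
        exact h2.mono_left nhdsWithin_le_nhds
      by_cases hP : i ∈ P
      · filter_upwards [ht.eventually (lt_mem_nhds ((hx.2 i hi).1 hP))] with ε hε
        exact ⟨fun _ => hε, fun h => absurd hP h⟩
      · filter_upwards [ht.eventually (gt_mem_nhds ((hx.2 i hi).2 hP))] with ε hε
        exact ⟨fun h => absurd h hP, fun _ => hε⟩
    filter_upwards [this] with ε hε
    refine ⟨fun i hi => ?_, hε⟩
    rw [map_add, map_smul, hw i hi, smul_zero, add_zero, hx.1 i hi]
  have k1 := key w hw
  have k2 := key (-w) (neg_mem hw)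
  have k3 : ∀ᶠ ε : ℝ in nhdsWithin 0 (Set.Ioi 0), 0 < ε := self_mem_nhdsWithin
  obtain ⟨ε, h1, h2, h3⟩ := (k1.and (k2.and k3)).exists
  refine ⟨ε, h3, h1, ?_⟩
  rwa [smul_neg, ← sub_eq_add_neg] at h2

lemma zR_convex (a : ι → V →ₗ[ℝ] ℝ) (c : ι → ℝ) (T S P : Finset ι) :
    Convex ℝ (zR a c T S P) := by
  have : zR a c T S P = (⋂ i ∈ T, {x | a i x = c i}) ∩
      (⋂ i ∈ S, ((⋂ _ : i ∈ P, {x | c i < a i x}) ∩ (⋂ _ : i ∉ P, {x | a i x < c i}))) := by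
    ext x; simp [zR]
  rw [this]
  refine Convex.inter (convex_iInter₂ fun i _ => convex_hyperplane (a i).isLinear _)
    (convex_iInter₂ fun i _ => Convex.inter (convex_iInter fun _ => ?_) (convex_iInter fun _ => ?_))
  · exact convex_halfSpace_gt (a i).isLinear _
  · exact convex_halfSpace_lt (a i).isLinear _

lemma zR_rec (a : ι → V →ₗ[ℝ] ℝ) (c : ι → ℝ) (T S P : Finset ι) :
    ∀ x ∈ zR a c T S P, ∀ v ∈ zK a T S P, ∀ t : ℝ, 0 ≤ t → x + t • v ∈ zR a c T S P := by
  intro x hx v hv t ht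
  refine ⟨fun i hi => ?_, fun i hi => ⟨fun hP => ?_, fun hP => ?_⟩⟩
  · rw [map_add, map_smul, hv.1 i hi, smul_zero, add_zero, hx.1 i hi]
  · have h1 := (hx.2 i hi).1 hP
    have h2 := mul_nonneg ht ((hv.2 i hi).1 hP)
    simp only [map_add, map_smul, smul_eq_mul]; linarith
  · have h1 := (hx.2 i hi).2 hP
    have h2 := mul_nonpos_of_nonneg_of_nonpos ht ((hv.2 i hi).2 hP)
    simp only [map_add, map_smul, smul_eq_mul]; linarith

lemma zK_comb (a : ι → V →ₗ[ℝ] ℝ) (T S P : Finset ι) :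
    ∀ u ∈ zK a T S P, ∀ v ∈ zK a T S P, ∀ s t : ℝ, 0 ≤ s → 0 ≤ t →
      s • u + t • v ∈ zK a T S P := by
  intro u hu v hv s t hs ht
  refine ⟨fun i hi => ?_, fun i hi => ⟨fun hP => ?_, fun hP => ?_⟩⟩
  · simp only [map_add, map_smul, smul_eq_mul, hu.1 i hi, hv.1 i hi]; ring
  · have h1 := mul_nonneg hs ((hu.2 i hi).1 hP)
    have h2 := mul_nonneg ht ((hv.2 i hi).1 hP)
    simp only [map_add, map_smul, smul_eq_mul]; linarith
  · have h1 := mul_nonpos_of_nonneg_of_nonpos hs ((hu.2 i hi).2 hP)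
    have h2 := mul_nonpos_of_nonneg_of_nonpos ht ((hv.2 i hi).2 hP)
    simp only [map_add, map_smul, smul_eq_mul]; linarith

lemma zK_N (a : ι → V →ₗ[ℝ] ℝ) (T S P : Finset ι) :
    ∀ u ∈ zK a T S P, ∀ v ∈ zK a T S P, ∀ s t : ℝ, 0 < s → 0 < t →
      (∀ i ∈ S, a i (s • u + t • v) = 0) → ∀ i ∈ S, a i u = 0 := by
  intro u hu v hv s t hs ht h i hi
  have h0 := h i hi
  simp only [map_add, map_smul, smul_eq_mul] at h0
  have : s * a i u = 0 := by
    by_cases hP : i ∈ P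
    · have h1 := mul_nonneg hs.le ((hu.2 i hi).1 hP)
      have h2 := mul_nonneg ht.le ((hv.2 i hi).1 hP)
      linarith
    · have h1 := mul_nonpos_of_nonneg_of_nonpos hs.le ((hu.2 i hi).2 hP)
      have h2 := mul_nonpos_of_nonneg_of_nonpos ht.le ((hv.2 i hi).2 hP)
      linarith
  exact (mul_eq_zero.1 this).resolve_left hs.ne'

lemma zL_insert_eq (a : ι → V →ₗ[ℝ] ℝ) (U : Finset ι) (h : ι) (hz : ∀ v ∈ zL a U, a h v = 0) :
    zL a (insert h U) = zL a U := by
  ext v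
  constructor
  · intro hv i hi; exact hv i (Finset.mem_insert_of_mem hi)
  · intro hv i hi
    rcases Finset.mem_insert.1 hi with rfl | hi
    · exact hz v hv
    · exact hv i hi

lemma zL_insert_finrank [FiniteDimensional ℝ V] (a : ι → V →ₗ[ℝ] ℝ) (U : Finset ι) (h : ι)
    (w : V) (hw : w ∈ zL a U) (hw1 : a h w ≠ 0) :
    Module.finrank ℝ (zL a (insert h U)) + 1 = Module.finrank ℝ (zL a U) := by
  let f : zL a U →ₗ[ℝ] ℝ := (a h).comp (zL a U).subtype
  have hf : Function.Surjective f := by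
    apply LinearMap.surjective
    intro h0
    exact hw1 (by simpa [f] using LinearMap.congr_fun h0 ⟨w, hw⟩)
  have h1 := LinearMap.finrank_range_add_finrank_ker f
  rw [LinearMap.range_eq_top.2 hf, finrank_top, Module.finrank_self] at h1
  have h2 : zL a (insert h U) = (LinearMap.ker f).map (zL a U).subtype := by
    ext v
    simp only [Submodule.mem_map, LinearMap.mem_ker, Submodule.subtype_apply]
    constructor
    · intro hv
      exact ⟨⟨v, fun i hi => hv i (Finset.mem_insert_of_mem hi)⟩,
        hv h (Finset.mem_insert_self _ _), rfl⟩
    · rintro ⟨⟨y, hy⟩, hy2, rfl⟩ i hi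
      rcases Finset.mem_insert.1 hi with rfl | hi
      · exact hy2
      · exact hy i hi
  rw [h2, Submodule.finrank_map_subtype_eq]
  omega

lemma zas_main [FiniteDimensional ℝ V] (a : ι → V →ₗ[ℝ] ℝ) (c : ι → ℝ) (S : Finset ι) :
    ∀ T, zb a c T S = (-1) ^ (Module.finrank ℝ (zL a T) + Module.finrank ℝ (zL a (T ∪ S)))
      * zchi a c T S := by
  induction S using Finset.induction_on with
  | empty =>
    intro T
    have hu : T ∪ ∅ = T := by ext; simp
    rw [hu, ← two_mul, pow_mul]
    unfold zb zchi
    rw [Finset.powerset_empty, Finset.sum_singleton, Finset.sum_singleton, hu]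
    simp [zG, zCen, zR]
  | insert h S hS ih =>
    intro T
    have ih1 := ih T
    have ih2 := ih (insert h T)
    rw [zchi_insert _ _ _ _ _ hS, zb_insert _ _ _ _ _ hS]
    rw [Finset.insert_union] at ih2
    rw [Finset.union_insert]
    have trans : ∀ P ∈ S.powerset, ((if zG a c T (insert h S) P then 1 else 0 : ℤ) +
        (if zG a c T (insert h S) (insert h P) then 1 else 0)) =
        ((if (∃ x ∈ zR a c T S P, a h x < c h) ∧ ∀ v ∈ zK a T S P,
          a h v ≤ 0 → ((∀ i ∈ S, a i v = 0) ∧ a h v = 0) then 1 else 0) +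
        (if (∃ x ∈ zR a c T S P, c h < a h x) ∧ ∀ v ∈ zK a T S P,
          0 ≤ a h v → ((∀ i ∈ S, a i v = 0) ∧ a h v = 0) then 1 else 0)) := by
      intro P hP
      have hP' : h ∉ P := fun h' => hS (Finset.mem_powerset.1 hP h')
      simp only [zG_neg a c T S P h hP', zG_pos a c T S P h hS]
    have z1 : ∀ P, (if zG a c T S P then 1 else 0 : ℤ) =
      (if (∃ x, x ∈ zR a c T S P) ∧ ∀ v ∈ zK a T S P, (∀ i ∈ S, a i v = 0) then 1 else 0) :=
      fun P => if_congr Iff.rfl rfl rfl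
    have z2 : ∀ P, (if zG a c (insert h T) S P then 1 else 0 : ℤ) =
      (if (∃ x ∈ zR a c T S P, a h x = c h) ∧ ∀ v ∈ zK a T S P,
        a h v = 0 → (∀ i ∈ S, a i v = 0) then 1 else 0) := by
      intro P; simp only [zG_zero]
    rw [Finset.sum_congr rfl trans]
    by_cases hA : ∀ v ∈ zL a T, a h v = 0
    · have hA2 : ∀ v ∈ zL a (T ∪ S), a h v = 0 :=
        fun v hv => hA v (fun i hi => hv i (Finset.mem_union_left _ hi))
      rw [zL_insert_eq a _ h hA, zL_insert_eq a _ h hA2] at ih2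
      rw [zL_insert_eq a _ h hA2, mul_sub, ← ih1, ← ih2]
      unfold zb
      rw [← Finset.sum_sub_distrib]
      apply Finset.sum_congr rfl
      intro P _
      rw [z1, z2]
      apply zas_caseA _ _ (fun v => ∀ i ∈ S, a i v = 0) (a h) (c h)
      · intro v hv; exact hA v hv.1
      · intro x hx y hy
        have := hA (x - y) (fun i hi => by rw [map_sub, hx.1 i hi, hy.1 i hi, sub_self])
        rw [map_sub] at this; linarith
    · push Not at hA
      obtain ⟨w, hw, hw1⟩ := hA
      have r1 := zL_insert_finrank a T h w hw hw1
      by_cases hB : ∀ v ∈ zL a (T ∪ S), a h v = 0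
      · rw [zL_insert_eq a _ h hB] at ih2 ⊢
        have : (-1 : ℤ) ^ (Module.finrank ℝ (zL a T) + Module.finrank ℝ (zL a (T ∪ S)))
            = - (-1) ^ (Module.finrank ℝ (zL a (insert h T)) + Module.finrank ℝ (zL a (T ∪ S))) := by
          rw [← r1]; ring
        rw [mul_sub, ← ih1, this, neg_mul, ← ih2, sub_neg_eq_add]
        unfold zb
        rw [← Finset.sum_add_distrib]
        apply Finset.sum_congr rfl
        intro P _
        rw [z1, z2]
        apply zas_caseB _ _ (fun v => ∀ i ∈ S, a i v = 0) (a h) (c h)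
        · exact zR_convex a c T S P
        · exact zR_rec a c T S P
        · exact zK_comb a T S P
        · exact zK_N a T S P
        · intro v hv hN
          apply hB
          intro i hi
          rcases Finset.mem_union.1 hi with hi | hi
          · exact hv.1 i hi
          · exact hN i hi
        · intro x hx
          rcases lt_or_gt_of_ne hw1 with h1 | h1
          · obtain ⟨ε, h2, h3, h4⟩ := zR_open a c T S P x hx (-w) (neg_mem hw)
            refine ⟨ε • (-w), ?_, h3, h4⟩
            rw [map_smul, map_neg, smul_eq_mul]
            exact mul_pos h2 (by linarith)
          · obtain ⟨ε, h2, h3, h4⟩ := zR_open a c T S P x hx w hw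
            refine ⟨ε • w, ?_, h3, h4⟩
            rw [map_smul, smul_eq_mul]
            exact mul_pos h2 h1
      · push Not at hB
        obtain ⟨w, hw, hw1⟩ := hB
        have r2 := zL_insert_finrank a (T ∪ S) h w hw hw1
        set w' := (a h w)⁻¹ • w with hw'
        have hwL : w' ∈ zL a (T ∪ S) := Submodule.smul_mem _ _ hw
        have hwφ : a h w' = 1 := by
          rw [hw', map_smul, smul_eq_mul, inv_mul_cancel₀ hw1]
        have hwT : ∀ i ∈ T, a i w' = 0 := fun i hi => hwL i (Finset.mem_union_left _ hi)
        have hwS : ∀ i ∈ S, a i w' = 0 := fun i hi => hwL i (Finset.mem_union_right _ hi)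
        have hP := fun P => zas_caseC (zR a c T S P) (zK a T S P) (fun v => ∀ i ∈ S, a i v = 0)
          (a h) (c h) w' hwφ
          ⟨hwT, fun i hi => by simp [hwS i hi]⟩
          ⟨fun i hi => by simp [hwT i hi], fun i hi => by simp [hwS i hi]⟩
          (fun x hx t => ⟨fun i hi => by simp [hwT i hi, hx.1 i hi],
            fun i hi => by simpa [hwS i hi] using hx.2 i hi⟩)
          (fun x hx t => ⟨fun i hi => by simp [hwT i hi, hx.1 i hi],
            fun i hi => by simpa [hwS i hi] using hx.2 i hi⟩)
          (fun v t hv i hi => by simpa [hwS i hi] using hv i hi)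
        have hbb : zb a c T S = zb a c (insert h T) S := by
          unfold zb
          apply Finset.sum_congr rfl
          intro P _
          rw [z1, z2]
          exact (hP P).2
        rw [Finset.sum_eq_zero (fun P _ => (hP P).1)]
        rw [ih1, ih2] at hbb
        have : (-1 : ℤ) ^ (Module.finrank ℝ (zL a (insert h T)) +
            Module.finrank ℝ (zL a (insert h (T ∪ S)))) = (-1 : ℤ) ^ (Module.finrank ℝ (zL a T) +
            Module.finrank ℝ (zL a (T ∪ S))) := by
          rw [← r1, ← r2]; ring
        rw [this] at hbb
        have h3 := mul_left_cancel₀ (pow_ne_zero _ (by norm_num : (-1 : ℤ) ≠ 0)) hbb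
        rw [h3, sub_self, mul_zero]

end Zas

section ZasFinal

/-- The linear functional attached to a hyperplane. -/
def zdot {n : ℕ} (p : (Fin n → ℝ) × ℝ) : (Fin n → ℝ) →ₗ[ℝ] ℝ where
  toFun x := ∑ i, p.1 i * x i
  map_add' x y := by simp [mul_add, Finset.sum_add_distrib]
  map_smul' t x := by
    simp only [Pi.smul_apply, smul_eq_mul, RingHom.id_apply, Finset.mul_sum]
    exact Finset.sum_congr rfl fun i _ => by ring

lemma zdot_apply {n : ℕ} (p : (Fin n → ℝ) × ℝ) (x : Fin n → ℝ) :
    zdot p x = ∑ i, p.1 i * x i := rfl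

lemma zdot_cont {n : ℕ} (p : (Fin n → ℝ) × ℝ) : Continuous (zdot p) :=
  (zdot p).continuous_of_finiteDimensional

lemma charPoly_eval_one {n : ℕ} (𝒜 : Finset ((Fin n → ℝ) × ℝ)) :
    (charPoly 𝒜).eval 1 = zchi zdot Prod.snd ∅ 𝒜 := by
  unfold charPoly zchi
  rw [Polynomial.eval_finsetSum, Finset.sum_filter]
  apply Finset.sum_congr rfl
  intro B _
  rw [z_empty_union]
  have : IsCentral B ↔ zCen zdot Prod.snd B := Iff.rfl
  by_cases h : zCen zdot Prod.snd B
  · rw [if_pos h, if_pos (this.2 h)]; simp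
  · rw [if_neg h, if_neg (fun h' => h (this.1 h'))]

lemma zL_full {n : ℕ} (𝒜 : Finset ((Fin n → ℝ) × ℝ)) (hrank : arrRank 𝒜 = n) :
    ∀ v, (∀ p ∈ 𝒜, zdot p v = 0) → v = 0 := by
  intro v hv
  have htop : Submodule.span ℝ (Prod.fst '' (𝒜 : Set ((Fin n → ℝ) × ℝ))) = ⊤ := by
    apply Submodule.eq_top_of_finrank_eq
    rw [Module.finrank_fin_fun]
    exact hrank
  have hle : Submodule.span ℝ (Prod.fst '' (𝒜 : Set ((Fin n → ℝ) × ℝ))) ≤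
      LinearMap.ker (zdot (v, 0)) := by
    rw [Submodule.span_le]
    rintro _ ⟨p, hp, rfl⟩
    have := hv p hp
    rw [zdot_apply] at this
    change zdot (v, 0) p.1 = 0
    rw [zdot_apply, ← this]
    exact Finset.sum_congr rfl fun i _ => mul_comm _ _
  rw [htop] at hle
  have h0 : zdot (v, 0) v = 0 := hle (Submodule.mem_top (x := v))
  rw [zdot_apply] at h0
  exact dotProduct_self_eq_zero.1 h0

lemma mem_hyp {n : ℕ} (𝒜 : Finset ((Fin n → ℝ) × ℝ)) (x : Fin n → ℝ) :
    x ∈ hypComplement 𝒜 ↔ ∀ p ∈ 𝒜, zdot p x ≠ p.2 := Iff.rfl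

lemma zR_subset {n : ℕ} (𝒜 P : Finset ((Fin n → ℝ) × ℝ)) :
    zR zdot Prod.snd ∅ 𝒜 P ⊆ hypComplement 𝒜 := by
  intro x hx
  rw [mem_hyp]
  intro p hp
  by_cases h : p ∈ P
  · exact ((hx.2 p hp).1 h).ne'
  · exact ((hx.2 p hp).2 h).ne

lemma comp_eq {n : ℕ} (𝒜 P : Finset ((Fin n → ℝ) × ℝ)) (x : Fin n → ℝ)
    (hx : x ∈ zR zdot Prod.snd ∅ 𝒜 P) :
    connectedComponentIn (hypComplement 𝒜) x = zR zdot Prod.snd ∅ 𝒜 P := by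
  have hxH := zR_subset 𝒜 P hx
  apply Set.Subset.antisymm
  · intro y hy
    have hpre := isPreconnected_connectedComponentIn (F := hypComplement 𝒜) (x := x)
    have hxm := mem_connectedComponentIn hxH
    have hsub := connectedComponentIn_subset (hypComplement 𝒜) x
    refine ⟨fun i hi => by simp at hi, fun p hp => ⟨fun hP => ?_, fun hP => ?_⟩⟩
    · by_contra! hc
      obtain ⟨z, hz, hz2⟩ := hpre.intermediate_value hy hxm (zdot_cont p).continuousOn
        ⟨hc, ((hx.2 p hp).1 hP).le⟩
      exact hsub hz p hp hz2
    · by_contra! hc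
      obtain ⟨z, hz, hz2⟩ := hpre.intermediate_value hxm hy (zdot_cont p).continuousOn
        ⟨((hx.2 p hp).2 hP).le, hc⟩
      exact hsub hz p hp hz2
  · exact (zR_convex zdot Prod.snd ∅ 𝒜 P).isPreconnected.subset_connectedComponentIn hx
      (zR_subset 𝒜 P)

lemma exists_sign {n : ℕ} (𝒜 : Finset ((Fin n → ℝ) × ℝ)) (x : Fin n → ℝ)
    (hx : x ∈ hypComplement 𝒜) :
    ∃ P ∈ 𝒜.powerset, x ∈ zR zdot Prod.snd ∅ 𝒜 P := by
  refine ⟨𝒜.filter fun p => p.2 < zdot p x, by simp, fun i hi => by simp at hi, fun p hp => ?_⟩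
  simp only [Finset.mem_filter, hp, true_and, imp_self, not_lt]
  exact fun h => lt_of_le_of_ne h (hx p hp)

lemma bdd_iff {n : ℕ} (𝒜 P : Finset ((Fin n → ℝ) × ℝ)) (hrank : arrRank 𝒜 = n)
    (x : Fin n → ℝ) (hx : x ∈ zR zdot Prod.snd ∅ 𝒜 P) :
    Bornology.IsBounded (zR zdot Prod.snd ∅ 𝒜 P) ↔
      ∀ v ∈ zK zdot ∅ 𝒜 P, ∀ p ∈ 𝒜, zdot p v = 0 := by
  constructor
  · intro hb v hv p hp
    suffices v = 0 by rw [this, map_zero]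
    by_contra hv0
    obtain ⟨C, hC⟩ := hb.exists_norm_le
    have hvn : 0 < ‖v‖ := norm_pos_iff.2 hv0
    have h1 := hC _ (zR_rec zdot Prod.snd ∅ 𝒜 P x hx v hv ((|C| + ‖x‖ + 1) / ‖v‖) (by positivity))
    have h2 : ‖((|C| + ‖x‖ + 1) / ‖v‖) • v‖ = |C| + ‖x‖ + 1 := by
      rw [norm_smul, Real.norm_of_nonneg (by positivity)]
      field_simp
    have h3 := norm_sub_le (x + ((|C| + ‖x‖ + 1) / ‖v‖) • v) x
    rw [add_sub_cancel_left, h2] at h3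
    have := le_abs_self C
    linarith
  · intro h
    by_contra hb
    have hseq : ∀ k : ℕ, ∃ y ∈ zR zdot Prod.snd ∅ 𝒜 P, (k : ℝ) + 1 < ‖y‖ := by
      intro k
      by_contra! hc
      exact hb (isBounded_iff_forall_norm_le.2 ⟨_, hc⟩)
    choose y hyR hyn using hseq
    have hpos : ∀ k, 0 < ‖y k‖ := fun k => lt_trans (by positivity) (hyn k)
    have hsph : ∀ k, ‖y k‖⁻¹ • y k ∈ Metric.sphere (0 : Fin n → ℝ) 1 := by
      intro k
      rw [mem_sphere_zero_iff_norm, norm_smul, norm_inv, norm_norm]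
      exact inv_mul_cancel₀ (hpos k).ne'
    obtain ⟨v, hv, ψ, hψ, hlim⟩ := (isCompact_sphere (0 : Fin n → ℝ) 1).tendsto_subseq hsph
    have hinv : Filter.Tendsto (fun k => ‖y (ψ k)‖⁻¹) Filter.atTop (nhds 0) := by
      apply Filter.Tendsto.inv_tendsto_atTop
      have h1 : Filter.Tendsto (fun k => ‖y k‖) Filter.atTop Filter.atTop :=
        Filter.tendsto_atTop_mono (fun k => by have := hyn k; linarith)
          tendsto_natCast_atTop_atTop
      exact h1.comp hψ.tendsto_atTop
    have hp1 : ∀ p : (Fin n → ℝ) × ℝ, Filter.Tendsto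
        (fun k => ‖y (ψ k)‖⁻¹ * (zdot p (y (ψ k)) - p.2)) Filter.atTop (nhds (zdot p v)) := by
      intro p
      have h1 := ((zdot_cont p).tendsto v).comp hlim
      have h2 := h1.sub (hinv.mul_const p.2)
      rw [zero_mul, sub_zero] at h2
      refine h2.congr fun k => ?_
      simp only [Function.comp, map_smul, smul_eq_mul]; ring
    have hvK : v ∈ zK zdot ∅ 𝒜 P := by
      refine ⟨fun i hi => by simp at hi, fun p hp => ⟨fun hP => ?_, fun hP => ?_⟩⟩
      · refine ge_of_tendsto' (hp1 p) fun k => ?_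
        have := ((hyR (ψ k)).2 p hp).1 hP
        exact mul_nonneg (inv_nonneg.2 (norm_nonneg _)) (by linarith)
      · refine le_of_tendsto' (hp1 p) fun k => ?_
        have := ((hyR (ψ k)).2 p hp).2 hP
        exact mul_nonpos_of_nonneg_of_nonpos (inv_nonneg.2 (norm_nonneg _)) (by linarith)
    have hv0 := zL_full 𝒜 hrank v (h v hvK)
    rw [hv0] at hv
    simp at hv

lemma ncard_eq_zb {n : ℕ} (𝒜 : Finset ((Fin n → ℝ) × ℝ)) (hrank : arrRank 𝒜 = n) :
    (({C ∈ chambers 𝒜 | Bornology.IsBounded C}).ncard : ℤ) = zb zdot Prod.snd ∅ 𝒜 := by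
  have himg : {C ∈ chambers 𝒜 | Bornology.IsBounded C} = (zR zdot Prod.snd ∅ 𝒜) ''
      ((𝒜.powerset.filter fun P => zG zdot Prod.snd ∅ 𝒜 P : Finset _) : Set _) := by
    ext C
    constructor
    · rintro ⟨⟨x, hx, rfl⟩, hb⟩
      obtain ⟨P, hP, hxP⟩ := exists_sign 𝒜 x hx
      have he := comp_eq 𝒜 P x hxP
      rw [he] at hb ⊢
      refine ⟨P, ?_, rfl⟩
      rw [Finset.mem_coe, Finset.mem_filter]
      exact ⟨hP, ⟨x, hxP⟩, (bdd_iff 𝒜 P hrank x hxP).1 hb⟩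
    · rintro ⟨P, hP, rfl⟩
      rw [Finset.mem_coe, Finset.mem_filter] at hP
      obtain ⟨hP, ⟨x, hxP⟩, hK⟩ := hP
      exact ⟨⟨x, zR_subset 𝒜 P hxP, (comp_eq 𝒜 P x hxP).symm⟩,
        (bdd_iff 𝒜 P hrank x hxP).2 hK⟩
  rw [himg, Set.InjOn.ncard_image, Set.ncard_coe_finset]
  · unfold zb
    rw [Finset.sum_boole]
  · intro P hP Q hQ hPQ
    rw [Finset.mem_coe, Finset.mem_filter] at hP hQ
    obtain ⟨hP, ⟨x, hxP⟩, -⟩ := hP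
    have hQ := hQ.1
    have hxQ := hxP
    rw [hPQ] at hxQ
    rw [Finset.mem_powerset] at hP hQ
    ext p
    constructor
    · intro h
      by_contra h'
      exact lt_asymm ((hxP.2 p (hP h)).1 h) ((hxQ.2 p (hP h)).2 h')
    · intro h
      by_contra h'
      exact lt_asymm ((hxQ.2 p (hQ h)).1 h) ((hxP.2 p (hQ h)).2 h')

end ZasFinal

/-- Zaslavsky's theorem for bounded chambers: if the arrangement `𝒜` in `ℝⁿ` has rank `n`,
then its number of bounded chambers equals `(−1)ⁿ χ_𝒜(1)`. -/
theorem statement17 (n : ℕ) (𝒜 : Finset ((Fin n → ℝ) × ℝ))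
    (hnz : ∀ p ∈ 𝒜, p.1 ≠ 0)
    (hinj : ∀ p ∈ 𝒜, ∀ q ∈ 𝒜,
      {x : Fin n → ℝ | ∑ i, p.1 i * x i = p.2} = {x : Fin n → ℝ | ∑ i, q.1 i * x i = q.2}
        → p = q)
    (hrank : arrRank 𝒜 = n) :
    (({C ∈ chambers 𝒜 | Bornology.IsBounded C}).ncard : ℤ)
      = (-1) ^ n * (charPoly 𝒜).eval 1 := by
  rw [ncard_eq_zb 𝒜 hrank, charPoly_eval_one, zas_main zdot Prod.snd 𝒜 ∅, z_empty_union]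
  have h1 : zL (zdot (n := n)) ∅ = ⊤ := by
    rw [eq_top_iff]
    intro x _ i hi
    simp at hi
  have h2 : zL zdot 𝒜 = ⊥ := by
    rw [eq_bot_iff]
    intro x hx
    exact (Submodule.mem_bot ℝ).2 (zL_full 𝒜 hrank x hx)
  rw [h1, h2, finrank_top, finrank_bot, Module.finrank_fin_fun, add_zero]
end
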